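/- Let α, β > −1 be fixed and let ξ, ξ₁, ξ₂, κ₁, κ₂ ≥ 0 be fixed with α + ξ₁ + κ₁ ≥ −1/2 and β + ξ₂ + κ₂ ≥ −1/2. Then there is a constant C such that for all θ ∈ (0,π/4) and φ ∈ (0,π) with θ ≠ φ: ∬_{[−1,1]²} q(θ,φ,u,v)^{−(α+β+ξ₁+ξ₂+ξ+1/2)} dΠ_{α+ξ₁+κ₁}(u) dΠ_{β+ξ₂+κ₂}(v) ≤ C [ 1 + 𝟙_{{α+ξ₁+ξ = 0}} log⁺(1/|θ−φ|) + (θ+φ)^{−2(α+ξ₁+ξ)} ( 1 + 𝟙_{{ξ = 1/2}} log((θ+φ)/|θ−φ|) + 𝟙_{{ξ > 1/2}} ((θ+φ)/|θ−φ|)^{2ξ−1} ) ]. Here log⁺ x = max(log x, 0). -/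

import Mathlib

open MeasureTheory Real Set
open scoped Classical

noncomputable section

/-- `log⁺ x = max (log x) 0`. -/
def logPlus (x : ℝ) : ℝ := max (Real.log x) 0

/-- The measure `dΠ_ν` on `[−1,1]`: for `ν > −1/2` the probability measure with density
`u ↦ Γ(ν+1)/(√π Γ(ν+1/2)) (1−u²)^{ν−1/2}`, and for `ν = −1/2` half the sum of the unit
point masses at `−1` and `1`. -/
def piMeasure (ν : ℝ) : Measure ℝ :=
  if ν = -1/2 then ((1:ENNReal)/2) • (Measure.dirac (-1) + Measure.dirac 1)
  else (volume.restrict (Set.Ioo (-1:ℝ) 1)).withDensity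
    (fun u => ENNReal.ofReal
      (Real.Gamma (ν+1) / (Real.sqrt π * Real.Gamma (ν+1/2)) * (1 - u^2) ^ (ν - 1/2)))

/-- `q(θ,φ,u,v) = 1 − u sin(θ/2)sin(φ/2) − v cos(θ/2)cos(φ/2)`. -/
def qFun (θ φ u v : ℝ) : ℝ :=
  1 - u * Real.sin (θ/2) * Real.sin (φ/2) - v * Real.cos (θ/2) * Real.cos (φ/2)


/-- model bound function -/
def FF (e x : ℝ) : ℝ := 1 + (if e = 0 then Real.log (1/x) else 0) + (if 0 < e then x ^ (-e) else 0)

lemma FF_ge_one (e x : ℝ) (hx : 0 < x) (hx1 : x ≤ 1) : 1 ≤ FF e x := by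
  unfold FF
  have h1 : 0 ≤ (if e = 0 then Real.log (1/x) else 0) := by
    split_ifs
    · exact Real.log_nonneg (by rw [le_div_iff₀ hx]; linarith)
    · exact le_rfl
  have h2 : 0 ≤ (if 0 < e then x ^ (-e) else 0) := by
    split_ifs
    · positivity
    · exact le_rfl
  linarith

/-- comparison of powers -/
lemma rpow_comp (c C' p : ℝ) (hc : 0 < c) (hC : 0 < C') : ∃ K : ℝ, 0 ≤ K ∧ ∀ y z : ℝ, 0 < y →
    c * y ≤ z → z ≤ C' * y → z ^ p ≤ K * y ^ p := by
  refine ⟨c ^ p + C' ^ p, by positivity, fun y z hy h1 h2 => ?_⟩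
  have hz : 0 < z := lt_of_lt_of_le (by positivity) h1
  rw [add_mul]
  have e1 : 0 ≤ c ^ p * y ^ p := by positivity
  have e2 : 0 ≤ C' ^ p * y ^ p := by positivity
  rcases le_total 0 p with hp | hp
  · have := Real.rpow_le_rpow hz.le h2 hp
    rw [Real.mul_rpow hC.le hy.le] at this
    linarith
  · have := Real.rpow_le_rpow_of_nonpos (by positivity) h1 hp
    rw [Real.mul_rpow hc.le hy.le] at this
    linarith

lemma rpow_raise (y p k : ℝ) (hy : 0 < y) (hy3 : y ≤ 3) (hk : 0 ≤ k) :
    y ^ (-p) ≤ 3 ^ k * y ^ (-(p + k)) := by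
  have : y ^ (-p) = y ^ k * y ^ (-(p+k)) := by
    rw [← Real.rpow_add hy]; congr 1; ring
  rw [this]
  gcongr

/-- one-dimensional elementary bound -/
lemma lemA (ρ e : ℝ) (hρ : 0 < ρ) (hP : 0 ≤ e + ρ) : ∃ C : ℝ, 0 ≤ C ∧ ∀ x : ℝ, 0 < x → x ≤ 1 →
    ∃ G : ℝ → ℝ, IntervalIntegrable G volume 0 2 ∧ (∀ t, 0 < t → 0 ≤ G t) ∧
      (∀ t, 0 < t → (x + t) ^ (-(e + ρ)) * t ^ (ρ - 1) ≤ G t) ∧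
      ∫ t in (0:ℝ)..2, G t ≤ C * FF e x := by
  have main : ∃ C : ℝ, 0 ≤ C ∧ ∀ x : ℝ, 0 < x → x ≤ 1 →
      x ^ (-(e+ρ)) * (x ^ ρ / ρ) + ∫ t in x..2, t ^ (-e-1) ≤ C * FF e x := by
    have h1 : ∀ x : ℝ, 0 < x → x ^ (-(e+ρ)) * (x ^ ρ / ρ) = x ^ (-e) / ρ := by
      intro x hx
      rw [← mul_div_assoc, ← Real.rpow_add hx]; congr 2; ring
    have hni : ∀ x : ℝ, 0 < x → (0:ℝ) ∉ Set.uIcc x 2 := by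
      intro x hx h
      rw [Set.mem_uIcc] at h
      rcases h with h | h <;> linarith [h.1, h.2]
    rcases lt_trichotomy e 0 with he | he | he
    · refine ⟨1/ρ + 2 ^ (-e) / (-e), by have : 0 < -e := by linarith
                                        positivity, fun x hx hx1 => ?_⟩
      rw [h1 x hx, integral_rpow (Or.inr ⟨by linarith, hni x hx⟩)]
      have hF : FF e x = 1 := by simp [FF, he.ne, not_lt.2 he.le]
      rw [hF, mul_one]
      have e1 : x ^ (-e) ≤ 1 := Real.rpow_le_one hx.le hx1 (by linarith)
      have e2 : 0 < x ^ (-e) := by positivity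
      have h3 : 0 < -e := by linarith
      have : -e - 1 + 1 = -e := by ring
      rw [this]
      gcongr
      linarith
    · subst he
      refine ⟨1/ρ + 1 + Real.log 2, by have := Real.log_nonneg (x := 2) (by norm_num)
                                       positivity, fun x hx hx1 => ?_⟩
      rw [h1 x hx]
      have : ∀ t : ℝ, t ^ (-(0:ℝ)-1) = t⁻¹ := by
        intro t; rw [show -(0:ℝ)-1 = -1 by ring, Real.rpow_neg_one]
      simp only [this]
      rw [integral_inv (hni x hx)]
      have hF : FF 0 x = 1 + Real.log (1/x) := by simp [FF]
      rw [hF]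
      have hl : 0 ≤ Real.log (1/x) := Real.log_nonneg (by rw [le_div_iff₀ hx]; linarith)
      have hl2 := Real.log_nonneg (x := 2) (by norm_num)
      rw [show (2:ℝ)/x = 2 * (1/x) by ring, Real.log_mul (by norm_num) (by positivity)]
      simp only [neg_zero, Real.rpow_zero]
      have : 0 < 1/ρ := by positivity
      nlinarith [mul_nonneg hl hl2, mul_nonneg this.le hl]
    · refine ⟨1/ρ + 1/e, by positivity, fun x hx hx1 => ?_⟩
      rw [h1 x hx, integral_rpow (Or.inr ⟨by linarith, hni x hx⟩)]
      have hF : FF e x = 1 + x ^ (-e) := by simp [FF, he.ne', he]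
      rw [hF]
      have e2 : 0 < x ^ (-e) := by positivity
      have e3 : (0:ℝ) < 2 ^ (-e) := by positivity
      have : -e - 1 + 1 = -e := by ring
      rw [this]
      have e4 : ((2:ℝ) ^ (-e) - x ^ (-e)) / (-e) = (x ^ (-e) - 2 ^ (-e)) * (1/e) := by
        field_simp; ring
      rw [e4, div_eq_mul_one_div]
      have i1 : 0 < 1/ρ := by positivity
      have i2 : 0 < 1/e := by positivity
      nlinarith [mul_pos e3 i2]
  obtain ⟨C, hC0, hC⟩ := main
  refine ⟨C, hC0, fun x hx hx1 => ?_⟩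
  set G : ℝ → ℝ := fun t => if t ≤ x then x ^ (-(e+ρ)) * t ^ (ρ - 1) else t ^ (-e-1) with hG
  have c1 : Set.EqOn (fun t : ℝ => x ^ (-(e+ρ)) * t ^ (ρ - 1)) G (Set.uIoc 0 x) := by
    intro t ht
    rw [Set.uIoc_of_le hx.le] at ht
    simp [hG, ht.2]
  have c2 : Set.EqOn (fun t : ℝ => t ^ (-e-1)) G (Set.uIoc x 2) := by
    intro t ht
    rw [Set.uIoc_of_le (by linarith)] at ht
    simp [hG, not_le.2 ht.1]
  have b1 : IntervalIntegrable (fun t : ℝ => x ^ (-(e+ρ)) * t ^ (ρ - 1)) volume 0 x :=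
    (intervalIntegral.intervalIntegrable_rpow' (r := ρ - 1) (by linarith)).const_mul _
  have b2 : IntervalIntegrable (fun t : ℝ => t ^ (-e-1)) volume x 2 := by
    apply intervalIntegral.intervalIntegrable_rpow
    right
    intro h
    rw [Set.mem_uIcc] at h
    rcases h with h | h <;> linarith [h.1, h.2]
  have i1 : IntervalIntegrable G volume 0 x := b1.congr c1
  have i2 : IntervalIntegrable G volume x 2 := b2.congr c2
  refine ⟨G, i1.trans i2, ?_, ?_, ?_⟩
  · intro t ht
    simp only [hG]
    split_ifs <;> positivity
  · intro t ht
    simp only [hG]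
    split_ifs with h
    · gcongr ?_ * _
      exact Real.rpow_le_rpow_of_nonpos hx (by linarith) (by linarith)
    · have : t ^ (-e-1) = t ^ (-(e+ρ)) * t ^ (ρ - 1) := by
        rw [← Real.rpow_add ht]; congr 1; ring
      rw [this]
      gcongr ?_ * _
      exact Real.rpow_le_rpow_of_nonpos ht (by linarith) (by linarith)
  · rw [← intervalIntegral.integral_add_adjacent_intervals i1 i2]
    have j1 : ∫ t in (0:ℝ)..x, G t = x ^ (-(e+ρ)) * (x ^ ρ / ρ) := by
      rw [← intervalIntegral.integral_congr_ae (Filter.Eventually.of_forall c1), intervalIntegral.integral_const_mul,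
        integral_rpow (Or.inl (by linarith))]
      simp [Real.zero_rpow hρ.ne']
    have j2 : ∫ t in x..2, G t = ∫ t in x..2, t ^ (-e-1) := by
      rw [← intervalIntegral.integral_congr_ae (Filter.Eventually.of_forall c2)]
    rw [j1, j2]
    exact hC x hx hx1

lemma q_bounds (θ φ u v : ℝ) (hθ : θ ∈ Set.Ioo 0 (π/4)) (hφ : φ ∈ Set.Ioo 0 π)
    (hu : u ∈ Set.Icc (-1:ℝ) 1) (hv : v ∈ Set.Icc (-1:ℝ) 1) :
    (1/800) * ((θ-φ)^2 + (θ+φ)^2*(1-u) + (1-v)) ≤ qFun θ φ u v ∧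
    qFun θ φ u v ≤ (θ-φ)^2 + (θ+φ)^2*(1-u) + (1-v) := by
  obtain ⟨h1, h2⟩ := hθ
  obtain ⟨h3, h4⟩ := hφ
  obtain ⟨hu1, hu2⟩ := hu
  obtain ⟨hv1, hv2⟩ := hv
  have hpi := Real.pi_gt_three
  have hpi2 := Real.pi_lt_d2
  set s := Real.sin (θ/2) * Real.sin (φ/2) with hs
  set c := Real.cos (θ/2) * Real.cos (φ/2) with hc
  set w := 2 * Real.sin ((θ-φ)/4)^2 with hw
  have hq : qFun θ φ u v = w + s * (1-u) + c * (1-v) := by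
    have e1 : Real.cos ((θ-φ)/2) = c + s := by
      rw [show (θ-φ)/2 = θ/2 - φ/2 by ring, Real.cos_sub]
    have e2 : Real.cos ((θ-φ)/2) = 1 - w := by
      rw [show (θ-φ)/2 = 2 * ((θ-φ)/4) by ring, Real.cos_two_mul, hw]
      have := Real.sin_sq_add_cos_sq ((θ-φ)/4)
      linarith
    have : qFun θ φ u v = 1 - u * s - v * c := by
      unfold qFun; rw [hs, hc]; ring
    rw [this]; linear_combination e1 - e2
  have sθ1 := Real.mul_le_sin (x := θ/2) (by linarith) (by linarith)
  have sφ1 := Real.mul_le_sin (x := φ/2) (by linarith) (by linarith)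
  have sθ2 := Real.sin_le (x := θ/2) (by linarith)
  have sφ2 := Real.sin_le (x := φ/2) (by linarith)
  have k : (3/10:ℝ) ≤ 1/π := by rw [le_div_iff₀ (by linarith)]; linarith
  have sθ3 : 3/10*θ ≤ Real.sin (θ/2) := by
    have : 2/π*(θ/2) = 1/π * θ := by ring
    nlinarith
  have sφ3 : 3/10*φ ≤ Real.sin (φ/2) := by
    have : 2/π*(φ/2) = 1/π * φ := by ring
    nlinarith
  have s1 : 9/100*(θ*φ) ≤ s := by
    have := mul_le_mul sθ3 sφ3 (by positivity) (by linarith)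
    linarith
  have s2 : s ≤ 1/4*(θ*φ) := by
    have := mul_le_mul sθ2 sφ2 (by linarith) (by positivity)
    linarith
  have w2 : w ≤ (θ-φ)^2/8 := by
    have := Real.sin_sq_le_sq (x := (θ-φ)/4)
    rw [hw]; linarith
  have w1 : 9/200 * (θ-φ)^2 ≤ w := by
    have := Real.mul_abs_le_abs_sin (x := (θ-φ)/4) (by rw [abs_le]; constructor <;> linarith)
    have h5 : 3/20 * |θ-φ| ≤ |Real.sin ((θ-φ)/4)| := by
      refine le_trans ?_ this
      rw [abs_div, abs_of_pos (show (0:ℝ)<4 by norm_num)]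
      have : 2/π*(|θ-φ|/4) = 1/π * (|θ-φ|/2) := by ring
      nlinarith [abs_nonneg (θ-φ)]
    have := pow_le_pow_left₀ (by positivity) h5 2
    rw [sq_abs, mul_pow, sq_abs] at this
    rw [hw]; linarith
  have cθ := Real.cos_le_one (θ/2)
  have cφ := Real.cos_le_one (φ/2)
  have cθ1 : 0 ≤ Real.cos (θ/2) := Real.cos_nonneg_of_mem_Icc ⟨by linarith, by linarith⟩
  have cφ1 : 0 ≤ Real.cos (φ/2) := Real.cos_nonneg_of_mem_Icc ⟨by linarith, by linarith⟩
  have c1 : c ≤ 1 := by rw [hc]; nlinarith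
  have c0 : 0 ≤ c := by rw [hc]; positivity
  have tp : 0 < θ * φ := by positivity
  have t0 : 0 ≤ 1 - u := by linarith
  have r0 : 0 ≤ 1 - v := by linarith
  have DD : (θ+φ)^2 = (θ-φ)^2 + 4 * (θ*φ) := by ring
  have A1 := mul_le_mul_of_nonneg_right s1 t0
  have A2 := mul_le_mul_of_nonneg_right s2 t0
  have d0 := sq_nonneg (θ-φ)
  have d1 := mul_nonneg d0 t0
  have d3 := mul_nonneg tp.le t0
  have d2 : (θ-φ)^2 * (1-u) ≤ (θ-φ)^2 * 2 := mul_le_mul_of_nonneg_left (by linarith) d0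
  rw [hq, DD]
  constructor
  · have key : (1/80) * ((θ-φ)^2 + ((θ-φ)^2 + 4 * (θ*φ))*(1-u)) ≤ w + s * (1-u) := by
      linarith
    rcases le_total φ (π/2) with hh | hh
    · have g1 := Real.one_sub_sq_div_two_le_cos (x := θ/2)
      have g2 := Real.one_sub_sq_div_two_le_cos (x := φ/2)
      have g31 : (θ/2)^2 ≤ (1/2)^2 := pow_le_pow_left₀ (by linarith) (by linarith) 2
      have g41 : (φ/2)^2 ≤ (1:ℝ)^2 := pow_le_pow_left₀ (by linarith) (by linarith) 2
      have g3 : 1/2 ≤ Real.cos (θ/2) := by linarith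
      have g4 : 1/2 ≤ Real.cos (φ/2) := by linarith
      have g5 : 1/4 ≤ c := by
        have := mul_le_mul g3 g4 (by norm_num) cθ1
        linarith
      have := mul_le_mul_of_nonneg_right g5 r0
      linarith
    · have g1 : 3/4 ≤ φ - θ := by linarith
      have g2 : 9/16 ≤ (θ-φ)^2 := by
        have := pow_le_pow_left₀ (by norm_num) g1 2
        linarith [show (φ-θ)^2 = (θ-φ)^2 by ring]
      have := mul_nonneg c0 r0
      linarith
  · have := mul_le_mul_of_nonneg_right c1 r0
    linarith

/-- the density of `piMeasure` -/
def piDens (ν v : ℝ) : ℝ :=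
  Real.Gamma (ν+1) / (Real.sqrt π * Real.Gamma (ν+1/2)) * (1 - v^2) ^ (ν - 1/2)

lemma piMeasure_of_ne (ν : ℝ) (h : ν ≠ -1/2) : piMeasure ν =
    (volume.restrict (Set.Ioo (-1:ℝ) 1)).withDensity (fun u => ENNReal.ofReal (piDens ν u)) := by
  unfold piMeasure piDens
  rw [if_neg h]

lemma piMeasure_ae (ν : ℝ) : ∀ᵐ v ∂(piMeasure ν), v ∈ Set.Icc (-1:ℝ) 1 := by
  by_cases h : ν = -1/2
  · unfold piMeasure
    rw [if_pos h]
    apply MeasureTheory.Measure.ae_smul_measure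
    rw [MeasureTheory.ae_add_measure_iff]
    constructor
    · exact (MeasureTheory.ae_dirac_iff (p := fun v : ℝ => v ∈ Set.Icc (-1:ℝ) 1) measurableSet_Icc).2
        (by norm_num)
    · exact (MeasureTheory.ae_dirac_iff (p := fun v : ℝ => v ∈ Set.Icc (-1:ℝ) 1) measurableSet_Icc).2
        (by norm_num)
  · rw [piMeasure_of_ne ν h]
    apply (MeasureTheory.withDensity_absolutelyContinuous _ _).ae_le
    filter_upwards [MeasureTheory.ae_restrict_mem measurableSet_Ioo] with v hv
    exact ⟨hv.1.le, hv.2.le⟩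

lemma piDens_const_pos (ν : ℝ) (h : -1/2 < ν) :
    0 < Real.Gamma (ν+1) / (Real.sqrt π * Real.Gamma (ν+1/2)) := by
  have h1 := Real.Gamma_pos_of_pos (s := ν+1) (by linarith)
  have h2 := Real.Gamma_pos_of_pos (s := ν+1/2) (by linarith)
  have := Real.pi_pos
  positivity

lemma piDens_nonneg (ν v : ℝ) (h : -1/2 < ν) (hv : v ∈ Set.Ioo (-1:ℝ) 1) : 0 ≤ piDens ν v := by
  have h1 := piDens_const_pos ν h
  have : 0 < 1 - v^2 := by nlinarith [hv.1, hv.2]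
  unfold piDens
  positivity

lemma pow_half (ρ w : ℝ) (hρ : 0 < ρ) (h1 : 1 ≤ w) (h2 : w ≤ 2) : w ^ (ρ - 1) ≤ 2 ^ ρ := by
  calc w ^ (ρ - 1) ≤ w ^ ρ := Real.rpow_le_rpow_of_exponent_le h1 (by linarith)
    _ ≤ 2 ^ ρ := Real.rpow_le_rpow (by linarith) h2 hρ.le

lemma dens_le_pos (ρ v : ℝ) (hρ : 0 < ρ) (h1 : 0 ≤ v) (h2 : v < 1) :
    (1 - v^2) ^ (ρ - 1) ≤ 2 ^ ρ * (1 - v) ^ (ρ - 1) := by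
  rw [show 1 - v^2 = (1+v)*(1-v) by ring, Real.mul_rpow (by linarith) (by linarith)]
  have : 0 ≤ (1-v) ^ (ρ - 1) := Real.rpow_nonneg (by linarith) _
  exact mul_le_mul_of_nonneg_right (pow_half ρ _ hρ (by linarith) (by linarith)) this

lemma dens_le_neg (ρ v : ℝ) (hρ : 0 < ρ) (h1 : v ≤ 0) (h2 : -1 < v) :
    (1 - v^2) ^ (ρ - 1) ≤ 2 ^ ρ * (1 + v) ^ (ρ - 1) := by
  have := dens_le_pos ρ (-v) hρ (by linarith) (by linarith)
  simpa using this

lemma int_plus (ρ : ℝ) (hρ : 0 < ρ) :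
    IntervalIntegrable (fun v : ℝ => (1+v) ^ (ρ - 1)) volume (-1) 1 := by
  have := (intervalIntegral.intervalIntegrable_rpow' (a := 0) (b := 2) (r := ρ - 1)
    (by linarith)).comp_add_left 1
  convert this using 2 <;> norm_num

lemma int_minus (G : ℝ → ℝ) (hG : IntervalIntegrable G volume 0 2) :
    IntervalIntegrable (fun v : ℝ => G (1-v)) volume (-1) 1 := by
  have := (hG.comp_sub_left 1).symm
  convert this using 2 <;> norm_num

lemma int_plus_val (ρ : ℝ) (hρ : 0 < ρ) :
    ∫ v in (-1:ℝ)..1, (1+v) ^ (ρ - 1) = 2 ^ ρ / ρ := by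
  rw [intervalIntegral.integral_comp_add_left (fun t : ℝ => t ^ (ρ-1)) 1,
    integral_rpow (Or.inl (by linarith))]
  norm_num
  rw [Real.zero_rpow hρ.ne', sub_zero]

lemma int_minus_val (G : ℝ → ℝ) :
    ∫ v in (-1:ℝ)..1, G (1-v) = ∫ t in (0:ℝ)..2, G t := by
  rw [intervalIntegral.integral_comp_sub_left G 1]
  norm_num

lemma piDens_integrable (ν : ℝ) (h : -1/2 < ν) :
    Integrable (piDens ν) (volume.restrict (Set.Ioo (-1:ℝ) 1)) := by
  set ρ := ν + 1/2 with hρd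
  have hρ : 0 < ρ := by linarith
  have hk := piDens_const_pos ν h
  set k := Real.Gamma (ν+1) / (Real.sqrt π * Real.Gamma (ν+1/2)) with hkd
  have i1 := int_plus ρ hρ
  have i2 := int_minus _ (intervalIntegral.intervalIntegrable_rpow' (a := 0) (b := 2) (r := ρ - 1)
    (by linarith))
  have i3 := ((i1.add i2).const_mul (k * 2^ρ)).1
  rw [integrableOn_Ioc_iff_integrableOn_Ioo] at i3
  refine MeasureTheory.Integrable.mono' i3 ?_ ?_
  · apply Measurable.aestronglyMeasurable
    unfold piDens
    fun_prop
  · filter_upwards [MeasureTheory.ae_restrict_mem measurableSet_Ioo] with v hv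
    rw [Real.norm_of_nonneg (piDens_nonneg ν v h hv)]
    have e1 : 0 ≤ (1+v) ^ (ρ - 1) := Real.rpow_nonneg (by linarith [hv.1]) _
    have e2 : 0 ≤ (1-v) ^ (ρ - 1) := Real.rpow_nonneg (by linarith [hv.2]) _
    unfold piDens
    rw [← hkd, show ν - 1/2 = ρ - 1 by rw [hρd]; ring, mul_assoc]
    apply mul_le_mul_of_nonneg_left _ hk.le
    have p2 : (0:ℝ) < 2 ^ ρ := by positivity
    rcases le_total v 0 with h0 | h0
    · have := dens_le_neg ρ v hρ h0 hv.1
      nlinarith [mul_nonneg p2.le e2]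
    · have := dens_le_pos ρ v hρ h0 hv.2
      nlinarith [mul_nonneg p2.le e1]

lemma piMeasure_finite (ν : ℝ) (h : -1/2 ≤ ν) : IsFiniteMeasure (piMeasure ν) := by
  by_cases h' : ν = -1/2
  · unfold piMeasure
    rw [if_pos h']
    constructor
    simp
  · have h2 : -1/2 < ν := lt_of_le_of_ne h (Ne.symm h')
    rw [piMeasure_of_ne ν h']
    exact isFiniteMeasure_withDensity_ofReal (piDens_integrable ν h2).2

lemma integrable_model (ν P x : ℝ) (h : -1/2 ≤ ν) (hx : 0 < x) (hx1 : x ≤ 1) :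
    Integrable (fun v => (x + (1 - v)) ^ (-P)) (piMeasure ν) := by
  have := piMeasure_finite ν h
  obtain ⟨K, hK, hK2⟩ := rpow_comp x 3 (-P) hx (by norm_num)
  apply MeasureTheory.Integrable.of_bound (C := K)
  · apply Measurable.aestronglyMeasurable
    fun_prop
  · filter_upwards [piMeasure_ae ν] with v hv
    have : 0 < x + (1-v) := by linarith [hv.2]
    rw [Real.norm_of_nonneg (by positivity)]
    have := hK2 1 (x+(1-v)) one_pos (by linarith [hv.2]) (by linarith [hv.1])
    simpa using this

lemma lemK (ν e : ℝ) (h : -1/2 ≤ ν) : ∃ C : ℝ, 0 ≤ C ∧ ∀ x : ℝ, 0 < x → x ≤ 1 →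
    ∫ v, (x + (1 - v)) ^ (-(e + (ν + 1/2))) ∂(piMeasure ν) ≤ C * FF e x := by
  have := piMeasure_finite ν h
  rcases lt_or_ge (e + (ν + 1/2)) 0 with hP | hP
  · refine ⟨3 ^ (-(e + (ν + 1/2))) * (piMeasure ν).real Set.univ, by positivity,
      fun x hx hx1 => ?_⟩
    have : ∫ v, (x + (1 - v)) ^ (-(e + (ν + 1/2))) ∂(piMeasure ν) ≤
        ∫ v, (3:ℝ) ^ (-(e + (ν + 1/2))) ∂(piMeasure ν) := by
      apply integral_mono_ae (integrable_model ν _ x h hx hx1) (integrable_const _)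
      filter_upwards [piMeasure_ae ν] with v hv
      exact Real.rpow_le_rpow (by linarith [hv.2]) (by linarith [hv.1]) (by linarith)
    rw [integral_const, smul_eq_mul, mul_comm] at this
    refine this.trans ?_
    have h2 := FF_ge_one e x hx hx1
    exact le_mul_of_one_le_right (by positivity) h2
  by_cases h' : ν = -1/2
  · have he : 0 ≤ e := by subst h'; linarith
    refine ⟨1, by norm_num, fun x hx hx1 => ?_⟩
    have hF : x ^ (-e) ≤ FF e x := by
      rcases he.eq_or_lt with h0 | h0
      · have := FF_ge_one e x hx hx1
        rw [← h0] at this ⊢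
        simpa using this
      · simp only [FF, h0.ne', h0, if_true, if_false]; linarith
    have e0 : e + (ν + 1/2) = e := by rw [h']; ring
    rw [e0]
    unfold piMeasure
    rw [if_pos h', integral_smul_measure, integral_add_measure
      (by exact integrable_dirac (by simp)) (by exact integrable_dirac (by simp)), integral_dirac, integral_dirac]
    have e1 : (x + (1 - -1)) ^ (-e) ≤ x ^ (-e) :=
      Real.rpow_le_rpow_of_nonpos hx (by linarith) (by linarith)
    simp only [sub_self, add_zero, smul_eq_mul]
    norm_num at e1 ⊢
    linarith
  · have hν : -1/2 < ν := lt_of_le_of_ne h (Ne.symm h')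
    set ρ := ν + 1/2 with hρd
    have hρ : 0 < ρ := by linarith
    have hk := piDens_const_pos ν hν
    obtain ⟨C, hC0, hC⟩ := lemA ρ e hρ hP
    set k := Real.Gamma (ν+1) / (Real.sqrt π * Real.Gamma ρ) with hkd
    have p2 : (0:ℝ) < 2 ^ ρ := by positivity
    refine ⟨k * 2^ρ * (2^ρ/ρ + C), by positivity, fun x hx hx1 => ?_⟩
    obtain ⟨G, G1, G2, G3, G4⟩ := hC x hx hx1
    rw [piMeasure_of_ne ν h', integral_withDensity_eq_integral_toReal_smul]
    rotate_left
    · unfold piDens; fun_prop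
    · exact Filter.Eventually.of_forall (fun _ => ENNReal.ofReal_lt_top)
    have i1 := ((int_plus ρ hρ).add (int_minus G G1)).const_mul (k * 2^ρ)
    have i3 := i1.1
    rw [integrableOn_Ioc_iff_integrableOn_Ioo] at i3
    have key : ∫ v in Set.Ioo (-1:ℝ) 1, (ENNReal.ofReal (piDens ν v)).toReal • (x + (1 - v)) ^ (-(e + ρ))
        ≤ ∫ v in Set.Ioo (-1:ℝ) 1, (k * 2^ρ) * (((fun v : ℝ => (1+v) ^ (ρ - 1)) + fun v => G (1-v)) v) := by
      apply integral_mono_of_nonneg _ i3 _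
      · filter_upwards [MeasureTheory.ae_restrict_mem measurableSet_Ioo] with v hv
        have : 0 < x + (1-v) := by linarith [hv.2]
        simp only [Pi.zero_apply, smul_eq_mul]
        positivity
      · filter_upwards [MeasureTheory.ae_restrict_mem measurableSet_Ioo] with v hv
        rw [ENNReal.toReal_ofReal (piDens_nonneg ν v hν hv), smul_eq_mul]
        have e1 : 0 ≤ (1+v) ^ (ρ - 1) := Real.rpow_nonneg (by linarith [hv.1]) _
        have g0 := G2 (1-v) (by linarith [hv.2])
        have g1 := G3 (1-v) (by linarith [hv.2])
        have hy : 0 < x + (1-v) := by linarith [hv.2]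
        have hz : 0 < 1 - v^2 := by nlinarith [hv.1, hv.2]
        have pd : piDens ν v = k * (1-v^2) ^ (ρ - 1) := by
          unfold piDens
          rw [hkd, hρd]
          congr 2
          ring
        rw [pd, mul_assoc, mul_assoc]
        apply mul_le_mul_of_nonneg_left _ hk.le
        have yp : 0 < (x + (1-v)) ^ (-(e+ρ)) := by positivity
        rcases le_total v 0 with h0 | h0
        · have a1 := dens_le_neg ρ v hρ h0 hv.1
          have a2 : (x + (1-v)) ^ (-(e+ρ)) ≤ 1 :=
            Real.rpow_le_one_of_one_le_of_nonpos (by linarith) (by linarith)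
          have a3 := mul_le_mul a1 a2 yp.le (by positivity)
          nlinarith [mul_nonneg p2.le g0]
        · have a1 := dens_le_pos ρ v hρ h0 hv.2
          have a3 := mul_le_mul_of_nonneg_right a1 yp.le
          have a4 := mul_le_mul_of_nonneg_left g1 p2.le
          nlinarith [mul_nonneg p2.le e1]
    refine key.trans ?_
    rw [← integral_Ioc_eq_integral_Ioo, ← intervalIntegral.integral_of_le (by norm_num),
      intervalIntegral.integral_const_mul]
    simp only [Pi.add_apply]
    rw [intervalIntegral.integral_add (int_plus ρ hρ) (int_minus G G1), int_plus_val ρ hρ,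
      int_minus_val, mul_assoc (k * 2^ρ)]
    apply mul_le_mul_of_nonneg_left _ (by positivity)
    have h2 := FF_ge_one e x hx hx1
    have h3 : 2^ρ/ρ ≤ 2^ρ/ρ * FF e x := le_mul_of_one_le_right (by positivity) h2
    linarith

set_option maxHeartbeats 1600000 in
/-- estimate for the double `dΠ` integral of a negative power of `q`,
uniform in `θ ∈ (0,π/4)` and `φ ∈ (0,π)`, `θ ≠ φ`. -/
theorem q_double_integral_estimate_near_zero
    (α β : ℝ) (hα : -1 < α) (hβ : -1 < β)
    (ξ ξ₁ ξ₂ κ₁ κ₂ : ℝ) (hξ : 0 ≤ ξ) (hξ₁ : 0 ≤ ξ₁) (hξ₂ : 0 ≤ ξ₂)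
    (hκ₁ : 0 ≤ κ₁) (hκ₂ : 0 ≤ κ₂)
    (h₁ : -1/2 ≤ α + ξ₁ + κ₁) (h₂ : -1/2 ≤ β + ξ₂ + κ₂) :
    ∃ C : ℝ, ∀ θ ∈ Set.Ioo 0 (π/4), ∀ φ ∈ Set.Ioo 0 π, θ ≠ φ →
      (∫ u, ∫ v, (qFun θ φ u v) ^ (-(α + β + ξ₁ + ξ₂ + ξ + 1/2))
          ∂(piMeasure (β + ξ₂ + κ₂)) ∂(piMeasure (α + ξ₁ + κ₁))) ≤
        C * (1 + (if α + ξ₁ + ξ = 0 then logPlus (1 / |θ - φ|) else 0) +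
          (θ + φ) ^ (-(2*(α + ξ₁ + ξ))) *
            (1 + (if ξ = 1/2 then Real.log ((θ + φ) / |θ - φ|) else 0) +
              (if 1/2 < ξ then ((θ + φ) / |θ - φ|) ^ (2*ξ - 1) else 0))) := by
  have hfin1 := piMeasure_finite (α + ξ₁ + κ₁) h₁
  have hfin2 := piMeasure_finite (β + ξ₂ + κ₂) h₂
  obtain ⟨K0, hK0, hq0⟩ := rpow_comp (1/800) 48 (-(α + β + ξ₁ + ξ₂ + ξ + 1/2))
    (by norm_num) (by norm_num)
  obtain ⟨C2, hC2, hI2⟩ := lemK (β + ξ₂ + κ₂) (α + ξ₁ + ξ) h₂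
  obtain ⟨C1, hC1, hI1⟩ := lemK (α + ξ₁ + κ₁) (ξ - 1/2) h₁
  set ν₁ := α + ξ₁ + κ₁ with hν₁
  set ν₂ := β + ξ₂ + κ₂ with hν₂
  set e := α + ξ₁ + ξ with he
  set p := α + β + ξ₁ + ξ₂ + ξ + 1/2 with hp
  have hl48 : 0 ≤ Real.log 48 := Real.log_nonneg (by norm_num)
  obtain ⟨K1, hK1d⟩ : ∃ K1, K1 = K0 * 3 ^ κ₂ * C2 := ⟨_, rfl⟩
  have hK1 : 0 ≤ K1 := by rw [hK1d]; positivity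
  obtain ⟨K2, hK2d⟩ : ∃ K2, K2 = 3 + Real.log 48 + 48 ^ e * 3 ^ κ₁ := ⟨_, rfl⟩
  obtain ⟨m, hm⟩ : ∃ m, m = (piMeasure ν₁).real Set.univ := ⟨_, rfl⟩
  have hm0 : 0 ≤ m := by rw [hm]; positivity
  have h48 : (0:ℝ) ≤ 48 ^ e * 3 ^ κ₁ := by positivity
  have hK2 : 0 ≤ K2 := by rw [hK2d]; positivity
  refine ⟨K1 * K2 * (m + C1 * 2), ?_⟩
  rintro θ hθ φ hφ hne
  have hd : 0 < |θ - φ| := abs_pos.2 (sub_ne_zero.2 hne)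
  have hD : 0 < θ + φ := by linarith [hθ.1, hφ.1]
  have hdD : |θ - φ| ≤ θ + φ := by
    rw [abs_le]; constructor <;> linarith [hθ.1, hφ.1]
  have hD4 : θ + φ ≤ 4 := by
    have := Real.pi_lt_d2
    linarith [hθ.2, hφ.2]
  set d := |θ - φ| with hdd
  set D := θ + φ with hDd
  have hdsq : (θ - φ)^2 = d^2 := by rw [hdd, sq_abs]
  have hDsq : D^2 ≤ 16 := by nlinarith
  have hdsq2 : d^2 ≤ D^2 := pow_le_pow_left₀ hd.le hdD 2
  have hd2 : 0 < d^2 := by positivity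
  have hD2 : 0 < D^2 := by positivity
  set L : ℝ := (if e = 0 then logPlus (1 / d) else 0) with hL
  have hL0 : 0 ≤ L := by
    rw [hL]; split_ifs
    · exact le_max_right _ _
    · exact le_rfl
  set δ := d^2 / D^2 with hδ
  have hδ0 : 0 < δ := by positivity
  have hδ1 : δ ≤ 1 := by rw [hδ, div_le_one hD2]; exact hdsq2
  set x : ℝ → ℝ := fun u => (d^2 + D^2 * (1-u)) / 48 with hx
  have hx0 : ∀ u ∈ Set.Icc (-1:ℝ) 1, 0 < x u := by
    intro u hu
    have : 0 ≤ D^2 * (1-u) := mul_nonneg hD2.le (by linarith [hu.2])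
    simp only [hx]; positivity
  have hx1 : ∀ u ∈ Set.Icc (-1:ℝ) 1, x u ≤ 1 := by
    intro u hu
    have : D^2 * (1-u) ≤ D^2 * 2 := mul_le_mul_of_nonneg_left (by linarith [hu.1]) hD2.le
    simp only [hx]; linarith
  have hqpos : ∀ u ∈ Set.Icc (-1:ℝ) 1, ∀ v ∈ Set.Icc (-1:ℝ) 1, 0 ≤ qFun θ φ u v := by
    intro u hu v hv
    have h1 := (q_bounds θ φ u v hθ hφ hu hv).1
    rw [hdsq, ← hDd] at h1
    have : 0 ≤ D^2 * (1-u) := mul_nonneg hD2.le (by linarith [hu.2])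
    linarith [hv.2]
  -- inner integral
  have inner : ∀ u ∈ Set.Icc (-1:ℝ) 1,
      ∫ v, (qFun θ φ u v) ^ (-p) ∂(piMeasure ν₂) ≤ K1 * FF e (x u) := by
    intro u hu
    have hxx := hx0 u hu
    have hxx1 := hx1 u hu
    have step : ∫ v, (qFun θ φ u v) ^ (-p) ∂(piMeasure ν₂) ≤
        ∫ v, (K0 * 3 ^ κ₂) * (x u + (1-v)) ^ (-(e + (ν₂ + 1/2))) ∂(piMeasure ν₂) := by
      apply integral_mono_of_nonneg
      · filter_upwards [piMeasure_ae ν₂] with v hv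
        exact Real.rpow_nonneg (hqpos u hu v hv) _
      · exact (integrable_model ν₂ _ (x u) h₂ hxx hxx1).const_mul _
      · filter_upwards [piMeasure_ae ν₂] with v hv
        have h1 := q_bounds θ φ u v hθ hφ hu hv
        rw [hdsq, ← hDd] at h1
        have hX : d^2 + D^2 * (1-u) = 48 * x u := by simp only [hx]; ring
        rw [hX] at h1
        have hy : 0 < x u + (1-v) := by linarith [hv.2]
        have h2 := hq0 (x u + (1-v)) (qFun θ φ u v) hy (by linarith [h1.1])
          (by linarith [h1.2, hv.2])
        have h3 := rpow_raise (x u + (1-v)) p κ₂ hy (by linarith [hv.1]) hκ₂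
        have h4 : p + κ₂ = e + (ν₂ + 1/2) := by rw [hp, he, hν₂]; ring
        rw [h4] at h3
        calc _ ≤ _ := h2
          _ ≤ K0 * (3 ^ κ₂ * (x u + (1-v)) ^ (-(e + (ν₂ + 1/2)))) :=
            mul_le_mul_of_nonneg_left h3 hK0
          _ = _ := by ring
    refine step.trans ?_
    rw [integral_const_mul, hK1d, mul_assoc (K0 * 3 ^ κ₂)]
    exact mul_le_mul_of_nonneg_left (hI2 (x u) hxx hxx1) (by positivity)
  -- pointwise bound
  have hW : 0 ≤ D ^ (-(2*e)) := Real.rpow_nonneg hD.le _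
  have pw : ∀ u ∈ Set.Icc (-1:ℝ) 1, FF e (x u) ≤
      K2 * (1 + L + D ^ (-(2*e)) * (δ + (1-u)) ^ (-((ξ - 1/2) + (ν₁ + 1/2)))) := by
    intro u hu
    have hxx := hx0 u hu
    have hxx1 := hx1 u hu
    have hy : 0 < δ + (1-u) := by linarith [hu.2]
    have hY : 0 ≤ D ^ (-(2*e)) * (δ + (1-u)) ^ (-((ξ - 1/2) + (ν₁ + 1/2))) := by positivity
    set Y := D ^ (-(2*e)) * (δ + (1-u)) ^ (-((ξ - 1/2) + (ν₁ + 1/2))) with hYd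
    have b1 : (if e = 0 then Real.log (1 / x u) else 0) ≤ Real.log 48 + 2 * L := by
      split_ifs with h0
      · have hLe : L = logPlus (1/d) := by rw [hL, if_pos h0]
        have hle : 1 / x u ≤ 48 * (1/d)^2 := by
          have hxd : d^2 / 48 ≤ x u := by
            have : 0 ≤ D^2 * (1-u) := mul_nonneg hD2.le (by linarith [hu.2])
            simp only [hx]; linarith
          calc 1 / x u ≤ 1 / (d^2/48) := one_div_le_one_div_of_le (by positivity) hxd
            _ = 48 * (1/d)^2 := by field_simp
        have h1 := Real.log_le_log (by positivity) hle
        rw [Real.log_mul (by norm_num) (by positivity), Real.log_pow] at h1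
        have h2 : Real.log (1/d) ≤ L := by rw [hLe]; exact le_max_left _ _
        push_cast at h1
        linarith
      · linarith
    have b2 : (if 0 < e then (x u) ^ (-e) else 0) ≤ 48 ^ e * 3 ^ κ₁ * Y := by
      split_ifs with h0
      · have hxe : x u = D^2 * ((δ + (1-u)) / 48) := by
          simp only [hx, hδ]; field_simp
        have h1 : (x u) ^ (-e) = D ^ (-(2*e)) * (48 ^ e * (δ + (1-u)) ^ (-e)) := by
          rw [hxe, Real.mul_rpow hD2.le (by positivity), Real.div_rpow hy.le (by norm_num),
            ← Real.rpow_natCast, ← Real.rpow_mul hD.le, Real.rpow_neg (by norm_num : (0:ℝ) ≤ 48)]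
          rw [div_inv_eq_mul, mul_comm ((δ + (1-u)) ^ (-e))]
          congr 2
          push_cast; ring
        have h3 := rpow_raise (δ + (1-u)) e κ₁ hy (by linarith [hu.1]) hκ₁
        have h4 : e + κ₁ = (ξ - 1/2) + (ν₁ + 1/2) := by rw [he, hν₁]; ring
        rw [h4] at h3
        rw [h1, hYd]
        calc _ ≤ D ^ (-(2*e)) * (48 ^ e * (3 ^ κ₁ * (δ + (1-u)) ^ (-((ξ - 1/2) + (ν₁ + 1/2))))) := by
              gcongr
          _ = _ := by ring
      · positivity
    have : FF e (x u) ≤ 1 + (Real.log 48 + 2 * L) + 48 ^ e * 3 ^ κ₁ * Y := by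
      unfold FF; linarith
    refine this.trans ?_
    rw [hK2d]
    nlinarith [mul_nonneg hl48 hL0, mul_nonneg hl48 hY, mul_nonneg h48 hL0]
  -- outer integral
  have hint := integrable_model ν₁ ((ξ - 1/2) + (ν₁ + 1/2)) δ h₁ hδ0 hδ1
  have outer : ∫ u, ∫ v, (qFun θ φ u v) ^ (-p) ∂(piMeasure ν₂) ∂(piMeasure ν₁) ≤
      ∫ u, (K1 * K2) * ((1 + L) + D ^ (-(2*e)) * (δ + (1-u)) ^ (-((ξ - 1/2) + (ν₁ + 1/2))))
        ∂(piMeasure ν₁) := by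
    apply integral_mono_of_nonneg
    · filter_upwards [piMeasure_ae ν₁] with u hu
      apply integral_nonneg_of_ae
      filter_upwards [piMeasure_ae ν₂] with v hv
      exact Real.rpow_nonneg (hqpos u hu v hv) _
    · exact ((integrable_const _).add (hint.const_mul _)).const_mul _
    · filter_upwards [piMeasure_ae ν₁] with u hu
      refine (inner u hu).trans ?_
      rw [mul_assoc]
      exact mul_le_mul_of_nonneg_left (pw u hu) hK1
  refine outer.trans ?_
  rw [integral_const_mul, integral_add (integrable_const _) (hint.const_mul _), integral_const,
    integral_const_mul, smul_eq_mul, ← hm, mul_assoc (K1 * K2)]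
  apply mul_le_mul_of_nonneg_left _ (mul_nonneg hK1 hK2)
  have hI := hI1 δ hδ0 hδ1
  have hr : 1 ≤ D / d := by rw [le_div_iff₀ hd]; linarith
  have hr0 : 0 < D / d := by positivity
  have hl : 0 ≤ Real.log (D / d) := Real.log_nonneg hr
  have hδr : 1 / δ = (D/d)^2 := by rw [hδ]; field_simp
  set B := 1 + (if ξ = 1/2 then Real.log (D / d) else 0) +
              (if 1/2 < ξ then (D / d) ^ (2*ξ - 1) else 0) with hB
  have f0 : 0 ≤ (if ξ = 1/2 then Real.log (D / d) else 0) := by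
    split_ifs
    · exact hl
    · exact le_rfl
  have f00 : 0 ≤ (if 1/2 < ξ then (D / d) ^ (2*ξ - 1) else 0) := by
    split_ifs
    · positivity
    · exact le_rfl
  have hB1 : 1 ≤ B := by rw [hB]; linarith
  have hF : FF (ξ - 1/2) δ ≤ 2 * B := by
    have f1 : (if ξ - 1/2 = 0 then Real.log (1/δ) else 0)
        = 2 * (if ξ = 1/2 then Real.log (D / d) else 0) := by
      by_cases h0 : ξ = 1/2
      · rw [if_pos h0, if_pos (by linarith), hδr, Real.log_pow]; norm_num
      · rw [if_neg h0, if_neg (fun h => h0 (by linarith)), mul_zero]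
    have f2 : (if 0 < ξ - 1/2 then δ ^ (-(ξ - 1/2)) else 0)
        = (if 1/2 < ξ then (D / d) ^ (2*ξ - 1) else 0) := by
      by_cases h0 : 1/2 < ξ
      · rw [if_pos h0, if_pos (by linarith), Real.rpow_neg hδ0.le, ← Real.inv_rpow hδ0.le,
          ← one_div, hδr, ← Real.rpow_natCast, ← Real.rpow_mul hr0.le]
        congr 1
        push_cast; ring
      · rw [if_neg h0, if_neg (fun h => h0 (by linarith))]
    unfold FF
    rw [f1, f2, hB]
    linarith
  have hJ := mul_le_mul_of_nonneg_left (hI.trans (mul_le_mul_of_nonneg_left hF hC1)) hW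
  have hWB : 0 ≤ D ^ (-(2*e)) * B := mul_nonneg hW (by linarith)
  nlinarith [mul_nonneg hm0 hWB, mul_nonneg hC1 hL0]

end
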